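/- Let f : ℝ² → ℝ be a Schwartz function and i ∈ {1,2}. Then ∫_{ℝ²} ξ_i ( Δf(ξ) + (1/2) ξ·∇f(ξ) + f(ξ) ) dξ = -(1/2) ∫_{ℝ²} ξ_i f(ξ) dξ. (The linear operator ℒf = Δf + (1/2)ξ·∇f + f scales first moments by the factor -1/2.) -/

import Mathlib

open MeasureTheory Real ENNReal

noncomputable section

abbrev E2 := EuclideanSpace ℝ (Fin 2)

def e (i : Fin 2) : E2 := EuclideanSpace.single i 1

/-- Partial derivative in the `i`-th coordinate direction. -/
def pd (i : Fin 2) (f : E2 → ℝ) (x : E2) : ℝ := fderiv ℝ f x (e i)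

/-- The Laplacian on `ℝ²`. -/
def lap (f : E2 → ℝ) (x : E2) : ℝ := ∑ i : Fin 2, pd i (pd i f) x


open LineDeriv in
/-- Schwartz partial derivative. -/
def sD (j : Fin 2) (g : SchwartzMap E2 ℝ) : SchwartzMap E2 ℝ := ∂_{e j} g

/-- Multiplication by a coordinate. -/
def sM (j : Fin 2) (g : SchwartzMap E2 ℝ) : SchwartzMap E2 ℝ :=
  SchwartzMap.smulLeftCLM ℝ (fun x : E2 => x j) g

theorem sD_apply (j : Fin 2) (g : SchwartzMap E2 ℝ) (x : E2) :
    sD j g x = fderiv ℝ g x (e j) := by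
  simp [sD, SchwartzMap.lineDerivOp_apply_eq_fderiv]

theorem coord_tg (j : Fin 2) : Function.HasTemperateGrowth (fun x : E2 => x j) :=
  (EuclideanSpace.proj j : E2 →L[ℝ] ℝ).hasTemperateGrowth

theorem sM_apply (j : Fin 2) (g : SchwartzMap E2 ℝ) (x : E2) :
    sM j g x = x j * g x := by
  simp [sM, SchwartzMap.smulLeftCLM_apply_apply (coord_tg j)]

theorem sDM_apply (j k : Fin 2) (g : SchwartzMap E2 ℝ) (x : E2) :
    sD j (sM k g) x = x k * sD j g x + (if k = j then 1 else 0) * g x := by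
  have h1 : (sM k g : E2 → ℝ) = fun x => x k * g x := funext (sM_apply k g)
  rw [sD_apply, sD_apply, h1]
  have hk : HasFDerivAt (fun x : E2 => x k)
      (EuclideanSpace.proj k : E2 →L[ℝ] ℝ) x :=
    (EuclideanSpace.proj k : E2 →L[ℝ] ℝ).hasFDerivAt
  have := (hk.mul (g.differentiableAt (x := x)).hasFDerivAt).fderiv
  rw [show (fun x : E2 => x k * g x) = (fun x : E2 => x k) * (g : E2 → ℝ) from rfl, this]
  simp [e, Pi.single_apply, mul_comm]

theorem integral_sD (j : Fin 2) (g : SchwartzMap E2 ℝ) : ∫ x, sD j g x = 0 := by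
  have := integral_mul_fderiv_eq_neg_fderiv_mul_of_integrable (μ := (volume : Measure E2))
    (f := fun _ : E2 => (1 : ℝ)) (g := (g : E2 → ℝ)) (v := e j) (𝕜 := ℝ)
    (by simp) (by simpa [← sD_apply] using (sD j g).integrable) (by simpa using g.integrable)
    (fun _ _ => by fun_prop) (fun _ _ => g.differentiableAt)
  simpa [← sD_apply] using this

theorem fderiv_self (f : SchwartzMap E2 ℝ) (x : E2) :
    fderiv ℝ f x x = ∑ j, x j * sD j f x := by
  have hx : x = ∑ j, x j • e j := by
    ext k; fin_cases k <;> simp [e, Fin.sum_univ_two]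
  rw [congrArg (fderiv ℝ f x) hx, map_sum]
  simp [sD_apply]

theorem integral_lin {A B C D : E2 → ℝ} (hA : Integrable A volume) (hB : Integrable B volume)
    (hC : Integrable C volume) (hD : Integrable D volume) {c d : ℝ} :
    ∫ x, (A x - B x + c * C x + d * D x)
      = (∫ x, A x) - (∫ x, B x) + c * (∫ x, C x) + d * ∫ x, D x := by
  have h1 : Integrable (fun x => A x - B x) volume := hA.sub hB
  have h2 : Integrable (fun x => A x - B x + c * C x) volume := h1.add (hC.const_mul c)
  rw [integral_add h2 (hD.const_mul d), integral_add h1 (hC.const_mul c), integral_sub hA hB,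
    integral_const_mul, integral_const_mul]

/-- The operator `ℒf = Δf + (1/2)ξ·∇f + f` scales first moments by `-1/2`:
`∫ ξ_i ℒf dξ = -(1/2) ∫ ξ_i f dξ` for Schwartz `f`. -/
theorem first_moment_of_L (f : SchwartzMap E2 ℝ) (i : Fin 2) :
    ∫ ξ, ξ i * (lap (⇑f) ξ + (1 / 2) * fderiv ℝ (⇑f) ξ ξ + f ξ)
      = -(1 / 2) * ∫ ξ, ξ i * f ξ := by
  have hlap : ∀ x, lap f x = ∑ j, sD j (sD j f) x := by
    intro x
    refine Finset.sum_congr rfl fun j _ => ?_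
    have : pd j f = sD j f := funext fun y => (sD_apply j f y).symm
    rw [this, sD_apply]; rfl
  have key : ∀ x, x i * (lap f x + (1 / 2) * fderiv ℝ f x x + f x)
      = (∑ j, sD j (sM i (sD j f)) x) - sD i f x
        + (1 / 2) * (∑ j, sD j (sM j (sM i f)) x) + -(1 / 2) * sM i f x := by
    intro x
    rw [hlap, fderiv_self]
    simp only [Fin.sum_univ_two, sDM_apply, sM_apply]
    fin_cases i <;> simp <;> ring
  have hI : ∀ g : SchwartzMap E2 ℝ, Integrable (fun x => g x) volume := fun g => g.integrable
  have hS : ∀ G : Fin 2 → SchwartzMap E2 ℝ, Integrable (fun x => ∑ j, G j x) volume :=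
    fun G => integrable_finsetSum _ fun j _ => hI _
  simp_rw [key]
  rw [integral_lin (hS fun j => sD j (sM i (sD j f))) (hI (sD i f))
      (hS fun j => sD j (sM j (sM i f))) (hI (sM i f)),
    integral_finsetSum _ fun j _ => hI _, integral_finsetSum _ fun j _ => hI _]
  simp only [integral_sD, sM_apply]
  simp
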